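/- Let S be a finite nonempty state set, Act a finite nonempty action set, and P : S × Act × S → [0,1] a transition function with ∑_{s'∈S} P(s' | s, a) = 1 for every s ∈ S and a ∈ Act. Let τmax ∈ ℕ and let P_τ : Ω × Ω → [0,1], with Ω = {0, 1, …, τmax}, satisfy ∑_{τ'∈Ω} P_τ(τ' | τ) = 1 for every τ ∈ Ω and P_τ(τ' | τ) = 0 whenever τ' > τ + 1. Define the k-step transition probabilities P^k(s' | s, a₁…a_k) recursively by P^0(s' | s) = 1 if s' = s and 0 otherwise, and P^k(s' | s, a₁…a_k) = ∑_{s''∈S} P(s'' | s, a₁) · P^{k−1}(s' | s'', a₂…a_k). A delayed state is a triple x = (s, w, τ) with s ∈ S, τ ∈ Ω, and w ∈ Act^τ an action buffer of length τ. Given a delayed state x = (s, w, τ) with τ ≤ τmax and an action a ∈ Act, write b = w·a for the buffer of length τ+1 obtained by appending a to w, and define P_d(x' | x, a) as follows: P_d((s, b, τ+1) | x, a) = P_τ(τ+1 | τ) (when τ+1 ≤ τmax); P_d((s', ⟨⟩, 0) | x, a) = P_τ(0 | τ) · P^{τ+1}(s' | s, b) for every s' ∈ S; for each τ' with 1 ≤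 τ' ≤ τ and every s' ∈ S, P_d((s', b↾suffix of length τ', τ') | x, a) = P_τ(τ' | τ) · P^{τ+1−τ'}(s' | s, first τ+1−τ' entries of b); and P_d(x' | x, a) = 0 for every other delayed state x'. Then P_d(x' | x, a) ≥ 0 for all x', and ∑_{x'} P_d(x' | x, a) = 1, where the sum ranges over all delayed states x'; i.e., P_d(· | x, a) is a valid conditional probability distribution over delayed states. -/

import Mathlib

open scoped Classical
open Finset

/-- `k`-step transition probabilities of the Basic MDP: `kStep P k s w s'` is the
probability of reaching `s'` from `s` by executing the `k` actions `w 0, …, w (k-1)`. -/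
noncomputable def kStep {S Act : Type} [Fintype S] (P : S → Act → S → ℝ) :
    (k : ℕ) → S → (Fin k → Act) → S → ℝ
  | 0, s, _, s' => if s' = s then 1 else 0
  | k + 1, s, w, s' => ∑ s'' : S, P s (w 0) s'' * kStep P k s'' (fun i => w i.succ) s'

/-- A delayed state: a triple `(s, w, τ)` with `τ ∈ Ω = {0,…,τmax}` and an action
buffer `w` of length `τ`. -/
abbrev DState (S Act : Type) (τmax : ℕ) := Σ τ : Fin (τmax + 1), S × (Fin τ.val → Act)

/-- The transition probability function of the Delayed Communication MDP. -/
noncomputable def Pd {S Act : Type} [Fintype S] [Fintype Act] {τmax : ℕ}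
    (P : S → Act → S → ℝ) (Ptau : Fin (τmax + 1) → Fin (τmax + 1) → ℝ)
    (x : DState S Act τmax) (a : Act) (x' : DState S Act τmax) : ℝ :=
  match x, x' with
  | ⟨τ, s, w⟩, ⟨τ', s', w'⟩ =>
    -- the buffer `b = w · a` of length `τ + 1` obtained by appending `a` to `w`
    let b : Fin (τ.val + 1) → Act := Fin.snoc w a
    if h1 : τ'.val = τ.val + 1 then
      -- Case 1: the delay increases by one; the observed state stays `s` and the
      -- buffer becomes `b`.
      if s' = s ∧ (∀ i : Fin τ'.val, w' i = b (Fin.cast h1 i)) then Ptau τ τ' else 0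
    else if τ'.val = 0 then
      -- Case 2: the delay drops to zero; the buffer empties and the state advances
      -- `τ + 1` steps along `b`.
      Ptau τ τ' * kStep P (τ.val + 1) s b s'
    else if h2 : τ'.val ≤ τ.val then
      -- Case 3: the delay drops to some `1 ≤ τ' ≤ τ`; the buffer becomes the suffix
      -- of `b` of length `τ'` and the state advances `τ + 1 - τ'` steps along the
      -- first `τ + 1 - τ'` entries of `b`.
      if ∀ i : Fin τ'.val,
          w' i = b ⟨i.val + (τ.val + 1 - τ'.val), by have := i.isLt; omega⟩ then
        Ptau τ τ' *
          kStep P (τ.val + 1 - τ'.val) s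
            (fun i => b ⟨i.val, by have := i.isLt; omega⟩) s'
      else 0
    else 0

theorem kStep_nonneg {S Act : Type} [Fintype S] {P : S → Act → S → ℝ}
    (hP0 : ∀ s a s', 0 ≤ P s a s') (k : ℕ) (s : S) (w : Fin k → Act) (s' : S) :
    0 ≤ kStep P k s w s' := by
  induction k generalizing s with
  | zero => rw [kStep]; split_ifs <;> norm_num
  | succ k ih => exact Finset.sum_nonneg fun s'' _ => mul_nonneg (hP0 _ _ _) (ih _ _)

theorem sum_kStep {S Act : Type} [Fintype S] {P : S → Act → S → ℝ}
    (hPsum : ∀ s a, ∑ s' : S, P s a s' = 1) (k : ℕ) (s : S) (w : Fin k → Act) :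
    ∑ s' : S, kStep P k s w s' = 1 := by
  induction k generalizing s with
  | zero => simp [kStep]
  | succ k ih =>
    simp only [kStep]
    rw [Finset.sum_comm]
    simp only [← Finset.mul_sum, ih, mul_one, hPsum]

theorem Pd_nonneg {S Act : Type} [Fintype S] [Fintype Act] {τmax : ℕ}
    {P : S → Act → S → ℝ} (hP0 : ∀ s a s', 0 ≤ P s a s')
    {Ptau : Fin (τmax + 1) → Fin (τmax + 1) → ℝ} (hT0 : ∀ τ τ', 0 ≤ Ptau τ τ')
    (x : DState S Act τmax) (a : Act) (x' : DState S Act τmax) :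
    0 ≤ Pd P Ptau x a x' := by
  obtain ⟨τ, s, w⟩ := x
  obtain ⟨τ', s', w'⟩ := x'
  dsimp only [Pd]
  split_ifs
  all_goals first
    | exact le_rfl
    | exact hT0 _ _
    | exact mul_nonneg (hT0 _ _) (kStep_nonneg hP0 _ _ _ _)

/-- The probability that the next delay is `τ'` is `Ptau τ τ'`. -/
theorem sum_Pd_delay {S Act : Type} [Fintype S] [Fintype Act] {τmax : ℕ}
    {P : S → Act → S → ℝ} (hPsum : ∀ s a, ∑ s' : S, P s a s' = 1)
    {Ptau : Fin (τmax + 1) → Fin (τmax + 1) → ℝ}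
    (hTbound : ∀ τ τ' : Fin (τmax + 1), τ.val + 1 < τ'.val → Ptau τ τ' = 0)
    (x : DState S Act τmax) (a : Act) (τ' : Fin (τmax + 1)) :
    ∑ y : S × (Fin τ'.val → Act), Pd P Ptau x a ⟨τ', y⟩ = Ptau x.1 τ' := by
  obtain ⟨τ, s, w⟩ := x
  rw [Fintype.sum_prod_type]
  dsimp only [Pd]
  split_ifs with h1 h2 h3
  · simp only [← funext_iff (g := fun i => (Fin.snoc w a : Fin (τ.val + 1) → Act) (Fin.cast h1 i)),
      ite_and, Finset.sum_ite_irrel, Finset.sum_ite_eq', Finset.sum_const_zero,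
      Finset.mem_univ, if_true]
  · have : IsEmpty (Fin τ'.val) := by rw [h2]; infer_instance
    simp only [Fintype.sum_unique, ← Finset.mul_sum, sum_kStep hPsum, mul_one]
  · simp only [← funext_iff, Finset.sum_ite_eq', Finset.mem_univ, if_true,
      ← Finset.mul_sum, sum_kStep hPsum, mul_one]
  · simp only [Finset.sum_const_zero]
    exact (hTbound _ _ (by omega)).symm

/-- The DC-MDP transition function `P_d(· | x, a)` is a valid conditional probability
distribution over delayed states: it is nonnegative and sums to one. -/
theorem dcmdp_transition_is_distribution {S Act : Type}
    [Fintype S] [Fintype Act] [Nonempty S] [Nonempty Act] {τmax : ℕ}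
    (P : S → Act → S → ℝ)
    (hP0 : ∀ s a s', 0 ≤ P s a s') (hP1 : ∀ s a s', P s a s' ≤ 1)
    (hPsum : ∀ s a, ∑ s' : S, P s a s' = 1)
    (Ptau : Fin (τmax + 1) → Fin (τmax + 1) → ℝ)
    (hT0 : ∀ τ τ', 0 ≤ Ptau τ τ') (hT1 : ∀ τ τ', Ptau τ τ' ≤ 1)
    (hTsum : ∀ τ, ∑ τ' : Fin (τmax + 1), Ptau τ τ' = 1)
    (hTbound : ∀ τ τ' : Fin (τmax + 1), τ.val + 1 < τ'.val → Ptau τ τ' = 0)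
    (x : DState S Act τmax) (a : Act) :
    (∀ x' : DState S Act τmax, 0 ≤ Pd P Ptau x a x') ∧
      ∑ x' : DState S Act τmax, Pd P Ptau x a x' = 1 := by
  refine ⟨Pd_nonneg hP0 hT0 x a, ?_⟩
  rw [Fintype.sum_sigma]
  simp only [sum_Pd_delay hPsum hTbound, hTsum]
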